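/- arXiv:2106.11366 — 3 statements merged into one kernel-verified Lean document; each statement's English description precedes it below -/
import Mathlib

section
/- Let φ : ℝ → ℝ be continuously differentiable and nonnegative, let ω_i < ω_{i+1} be two real numbers, and let L ≥ 0 be a first-order upper bound for φ on [ω_i, ω_{i+1}], i.e. |φ'(ω)| ≤ L for all ω ∈ [ω_i, ω_{i+1}]. Let γ* be a real number with γ* ≥ max{φ(ω_i), φ(ω_{i+1})} and let τ > 0 be a tolerance. If L·(ω_{i+1} − ω_i) < 2γ* + 2τ − φ(ω_i) − φ(ω_{i+1}), then φ(ω) < γ* + τ for every ω ∈ [ω_i, ω_{i+1}]. -/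
/-- Lemma 2 (Apkarian–Noll accuracy certificate): if `φ` is continuously
differentiable and nonnegative, `L` is a first-order upper bound for `φ` on
`[ω₁, ω₂]` (i.e. `|φ'(ω)| ≤ L` there), `γ* ≥ max {φ(ω₁), φ(ω₂)}`, `τ > 0`, and
`L (ω₂ - ω₁) < 2 γ* + 2 τ - φ(ω₁) - φ(ω₂)`, then `φ(ω) < γ* + τ` on `[ω₁, ω₂]`. -/
theorem adaptive_sampling_accuracy_certificate
    (φ : ℝ → ℝ) (hφ : ContDiff ℝ 1 φ) (hφnonneg : ∀ ω, 0 ≤ φ ω)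
    (ω₁ ω₂ : ℝ) (hω : ω₁ < ω₂)
    (L : ℝ) (hL : 0 ≤ L)
    (hbound : ∀ ω ∈ Set.Icc ω₁ ω₂, |deriv φ ω| ≤ L)
    (γstar : ℝ) (hγstar : max (φ ω₁) (φ ω₂) ≤ γstar)
    (τ : ℝ) (hτ : 0 < τ)
    (hcrit : L * (ω₂ - ω₁) < 2 * γstar + 2 * τ - φ ω₁ - φ ω₂) :
    ∀ ω ∈ Set.Icc ω₁ ω₂, φ ω < γstar + τ := by
  intro ω hmem
  have lipschitz : ∀ x ∈ Set.Icc ω₁ ω₂, |φ ω - φ x| ≤ L * |ω - x| := fun x hx =>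
    (convex_Icc ω₁ ω₂).norm_image_sub_le_of_norm_deriv_le
      (fun y _ => (hφ.differentiable one_ne_zero).differentiableAt) hbound hx hmem
  have left := (le_abs_self _).trans (lipschitz ω₁ (Set.left_mem_Icc.2 hω.le))
  have right := (le_abs_self _).trans (lipschitz ω₂ (Set.right_mem_Icc.2 hω.le))
  rw [abs_of_nonneg (sub_nonneg.2 hmem.1)] at left
  rw [abs_of_nonpos (sub_nonpos.2 hmem.2)] at right
  linarith
end

section
/- Let J, R, Q ∈ ℝ^{n×n} with J = −Jᵀ and R, Q symmetric positive semidefinite. Then every eigenvalue λ ∈ ℂ of the matrix (J − R)Q satisfies Re(λ) ≤ 0. -/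
open Matrix

/-- A complex eigenvector of a real matrix splits into real and imaginary parts, which gives a
real-quadratic-form criterion for the spectrum to lie in the closed left half-plane. -/
theorem Matrix.re_nonpos_of_mem_spectrum_map_ofReal {ι : Type*} [Fintype ι] [DecidableEq ι]
    {B : Matrix ι ι ℝ} (hB : ∀ x : ι → ℝ, x ⬝ᵥ (B *ᵥ x) ≤ 0) {z : ℂ}
    (hz : z ∈ spectrum ℂ (B.map Complex.ofReal)) : z.re ≤ 0 := by
  rw [← Matrix.spectrum_toLin', ← Module.End.hasEigenvalue_iff_mem_spectrum] at hz
  obtain ⟨v, hv⟩ := hz.exists_hasEigenvector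
  have hv0 : v ≠ 0 := hv.2
  have hBv : B.map Complex.ofReal *ᵥ v = z • v := by simpa using hv.apply_eq_smul
  set x : ι → ℝ := fun i ↦ (v i).re with hx
  set y : ι → ℝ := fun i ↦ (v i).im with hy
  have hBx : B *ᵥ x = z.re • x - z.im • y := by
    ext i
    simpa [hx, hy, mulVec, dotProduct] using congrArg Complex.re (congrFun hBv i)
  have hBy : B *ᵥ y = z.re • y + z.im • x := by
    ext i
    simpa [hx, hy, mulVec, dotProduct] using congrArg Complex.im (congrFun hBv i)
  have hsum : z.re * (x ⬝ᵥ x + y ⬝ᵥ y) ≤ 0 := by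
    have h := add_nonpos (hB x) (hB y)
    simp only [hBx, hBy, dotProduct_sub, dotProduct_add, dotProduct_smul, smul_eq_mul,
      dotProduct_comm y x] at h
    linarith
  have hx0 : 0 ≤ x ⬝ᵥ x := by simpa using dotProduct_star_self_nonneg x
  have hy0 : 0 ≤ y ⬝ᵥ y := by simpa using dotProduct_star_self_nonneg y
  by_contra! hpos
  have hxy : x ⬝ᵥ x + y ⬝ᵥ y ≤ 0 := nonpos_of_mul_nonpos_right hsum hpos
  have hxz : x = 0 := dotProduct_self_eq_zero.mp (by linarith)
  have hyz : y = 0 := dotProduct_self_eq_zero.mp (by linarith)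
  exact hv0 (funext fun i ↦ Complex.ext (congrFun hxz i) (congrFun hyz i))

theorem Matrix.dotProduct_mulVec_self_eq_zero_of_eq_neg_transpose {ι : Type*} [Fintype ι]
    {J : Matrix ι ι ℝ} (hJ : J = -Jᵀ) (x : ι → ℝ) : x ⬝ᵥ (J *ᵥ x) = 0 := by
  have h : x ⬝ᵥ (J *ᵥ x) = -(x ⬝ᵥ (J *ᵥ x)) := by
    conv_lhs => rw [hJ, neg_mulVec, dotProduct_neg, mulVec_transpose, dotProduct_comm,
      ← dotProduct_mulVec]
  linarith

/-- Spectral stability of port-Hamiltonian systems: if `J = -Jᵀ` and `R, Q`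
are real symmetric positive semidefinite, then every (complex) eigenvalue `λ`
of the system matrix `(J - R) Q` satisfies `Re λ ≤ 0`. -/
theorem pH_eigenvalues_left_halfplane (n : ℕ)
    (J R Q : Matrix (Fin n) (Fin n) ℝ)
    (hJ : J = -Jᵀ) (hR : R.PosSemidef) (hQ : Q.PosSemidef)
    (lam : ℂ)
    (hlam : lam ∈ spectrum ℂ (((J - R) * Q).map Complex.ofReal)) :
    lam.re ≤ 0 := by
  obtain ⟨L, rfl⟩ : ∃ L : Matrix (Fin n) (Fin n) ℝ, Q = Lᵀ * L := by
    open scoped MatrixOrder in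
    simpa [star_eq_conjTranspose] using
      CStarAlgebra.nonneg_iff_eq_star_mul_self.mp hQ.nonneg
  rcases eq_or_ne lam 0 with rfl | h0
  · simp
  have hcomm : lam ∈ spectrum ℂ ((L * ((J - R) * Lᵀ)).map Complex.ofReal) := by
    have hmap (A B : Matrix (Fin n) (Fin n) ℝ) :
        (A * B).map Complex.ofReal = A.map Complex.ofReal * B.map Complex.ofReal :=
      Matrix.map_mul (f := Complex.ofRealHom)
    have hmem : lam ∈ spectrum ℂ (((J - R) * Lᵀ).map Complex.ofReal * L.map Complex.ofReal) \ {0} :=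
      ⟨by rwa [← hmap, Matrix.mul_assoc], h0⟩
    rw [spectrum.nonzero_mul_comm, ← hmap] at hmem
    exact hmem.1
  refine Matrix.re_nonpos_of_mem_spectrum_map_ofReal (fun x ↦ ?_) hcomm
  have hRx : 0 ≤ (Lᵀ *ᵥ x) ⬝ᵥ (R *ᵥ (Lᵀ *ᵥ x)) := by
    simpa using hR.dotProduct_mulVec_nonneg (Lᵀ *ᵥ x)
  have hJx := Matrix.dotProduct_mulVec_self_eq_zero_of_eq_neg_transpose hJ (Lᵀ *ᵥ x)
  rw [← mulVec_mulVec, ← mulVec_mulVec, dotProduct_mulVec, ← mulVec_transpose, sub_mulVec,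
    dotProduct_sub, hJx]
  linarith
end

section
/- Let J, R, Q ∈ ℝ^{n×n} with J = −Jᵀ and R, Q symmetric positive semidefinite, and let B ∈ ℝ^{n×m}. Let λ ∈ ℂ with Re(λ) > 0 be such that λ I_n − (J − R)Q is invertible (viewing the real matrices as complex matrices). Then the Hermitian part of the transfer function value H(λ) = Bᵀ Q (λ I_n − (J − R)Q)^{-1} B is positive semidefinite, i.e. z* (H(λ) + H(λ)*) z ≥ 0 for all z ∈ ℂ^m. -/
open Matrix
open scoped ComplexOrder

open scoped MatrixOrder in
/-- The complexification of a real positive semidefinite matrix is positive semidefinite. -/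
theorem Matrix.PosSemidef.map_complex_ofReal {ι : Type*} [Fintype ι] {A : Matrix ι ι ℝ}
    (hA : A.PosSemidef) : (A.map Complex.ofReal).PosSemidef := by
  classical
  obtain ⟨C, rfl⟩ := CStarAlgebra.nonneg_iff_eq_star_mul_self.mp hA.nonneg
  have h : (star C * C).map Complex.ofReal = (C.map Complex.ofReal)ᴴ * C.map Complex.ofReal := by
    ext i j
    simp [Matrix.mul_apply, star_eq_conjTranspose]
  rw [h]
  exact posSemidef_conjTranspose_mul_self _

/-- The Lyapunov-type expression `Mᴴ Q + Q M` for `M = λ I - (J - R) Q` with `J` skew-Hermitian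
and `R`, `Q` Hermitian equals `2 Re λ Q + 2 Q R Q`. -/
theorem conjTranspose_mul_add_mul_resolvent {ι : Type*} [Fintype ι] [DecidableEq ι]
    {J R Q : Matrix ι ι ℂ} (hJ : Jᴴ = -J) (hR : R.IsHermitian) (hQ : Q.IsHermitian) (lam : ℂ) :
    (lam • (1 : Matrix ι ι ℂ) - (J - R) * Q)ᴴ * Q + Q * (lam • (1 : Matrix ι ι ℂ) - (J - R) * Q) =
      ((2 * lam.re : ℝ) : ℂ) • Q + (2 : ℂ) • (Qᴴ * R * Q) := by
  have hlam : ((2 * lam.re : ℝ) : ℂ) = star lam + lam := by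
    rw [add_comm]
    exact (Complex.add_conj lam).symm
  simp only [conjTranspose_sub, conjTranspose_smul, conjTranspose_one, conjTranspose_mul, hJ,
    hR.eq, hQ.eq, hlam, two_smul, add_smul, sub_mul, mul_sub, smul_mul_assoc, mul_smul_comm,
    one_mul, mul_one, neg_mul, mul_neg, Matrix.mul_assoc]
  abel

/-- If `M` is invertible and `Mᴴ Q + Q M` is positive semidefinite with `Q` Hermitian, then
`Bᴴ Q M⁻¹ B` has positive semidefinite Hermitian part. -/
theorem posSemidef_add_conjTranspose_of_isUnit {ι κ : Type*} [Fintype ι] [DecidableEq ι]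
    [Fintype κ] {M Q : Matrix ι ι ℂ} (hM : IsUnit M) (hQ : Q.IsHermitian)
    (hMQ : (Mᴴ * Q + Q * M).PosSemidef) (B : Matrix ι κ ℂ) :
    (Bᴴ * Q * M⁻¹ * B + (Bᴴ * Q * M⁻¹ * B)ᴴ).PosSemidef := by
  have hB : M * (M⁻¹ * B) = B :=
    Matrix.mul_nonsing_inv_cancel_left M B ((Matrix.isUnit_iff_isUnit_det M).mp hM)
  have hH : Bᴴ * Q * M⁻¹ * B = (M⁻¹ * B)ᴴ * (Mᴴ * Q) * (M⁻¹ * B) := by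
    rw [← Matrix.mul_assoc (M⁻¹ * B)ᴴ, ← conjTranspose_mul, hB, Matrix.mul_assoc (Bᴴ * Q)]
  convert hMQ.conjTranspose_mul_mul_same (M⁻¹ * B) using 1
  rw [hH]
  generalize M⁻¹ * B = X
  simp only [conjTranspose_mul, conjTranspose_conjTranspose, hQ.eq, Matrix.mul_add,
    Matrix.add_mul, Matrix.mul_assoc]

/-- Positive realness of port-Hamiltonian transfer functions: for `J = -Jᵀ`,
`R, Q` real symmetric positive semidefinite, `B ∈ ℝ^{n×m}`, and `λ ∈ ℂ` with
`Re λ > 0` such that `λ Iₙ - (J - R) Q` is invertible (over `ℂ`), the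
Hermitian part of `H(λ) = Bᵀ Q (λ Iₙ - (J - R) Q)⁻¹ B` is positive
semidefinite, i.e. `H(λ) + H(λ)*` is a positive semidefinite matrix. -/
theorem pH_transfer_function_positive_real (n m : ℕ)
    (J R Q : Matrix (Fin n) (Fin n) ℝ) (B : Matrix (Fin n) (Fin m) ℝ)
    (hJ : J = -Jᵀ) (hR : R.PosSemidef) (hQ : Q.PosSemidef)
    (lam : ℂ) (hre : 0 < lam.re)
    (hinv : IsUnit
      (lam • (1 : Matrix (Fin n) (Fin n) ℂ) - ((J - R) * Q).map Complex.ofReal))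
    (H : Matrix (Fin m) (Fin m) ℂ)
    (hH : H = (Bᵀ * Q).map Complex.ofReal *
      (lam • (1 : Matrix (Fin n) (Fin n) ℂ) - ((J - R) * Q).map Complex.ofReal)⁻¹ *
      B.map Complex.ofReal) :
    (H + Hᴴ).PosSemidef := by
  have hJc : (J.map Complex.ofReal)ᴴ = -J.map Complex.ofReal := by
    ext i j
    have h : J j i = -J i j := congrFun (congrFun hJ j) i
    simp [h]
  have hRc := hR.map_complex_ofReal
  have hQc := hQ.map_complex_ofReal
  have hmap : ((J - R) * Q).map Complex.ofReal =
      (J.map Complex.ofReal - R.map Complex.ofReal) * Q.map Complex.ofReal := by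
    ext i j
    simp [Matrix.mul_apply]
  have hBQ : (Bᵀ * Q).map Complex.ofReal =
      (B.map Complex.ofReal)ᴴ * Q.map Complex.ofReal := by
    ext i j
    simp [Matrix.mul_apply]
  rw [hmap] at hinv hH
  rw [hH, hBQ]
  refine posSemidef_add_conjTranspose_of_isUnit hinv hQc.isHermitian ?_ _
  rw [conjTranspose_mul_add_mul_resolvent hJc hRc.isHermitian hQc.isHermitian]
  refine (hQc.smul ?_).add ((hRc.conjTranspose_mul_mul_same _).smul zero_le_two)
  exact Complex.zero_le_real.mpr (by positivity)
end
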